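/- arXiv:2511.08781 — 2 statements merged into one kernel-verified Lean document; each statement's English description precedes it below -/
import Mathlib

section
/- Let d = 1, let σ : ℝ → ℝ be a bounded Borel function with σ(x) ≠ σ(y) whenever x ≠ y, let a(x) = σ(x)², and let b = 0, so that Lf(x) = a(x) f''(x). If μ is a Borel probability measure on ℝ such that ∫_ℝ a(x) f''(x) μ(dx) = 0 for every f ∈ C_c^∞(ℝ), then there exists a point x₀ ∈ ℝ with a(x₀) = 0 and μ = δ_{x₀}. -/
open MeasureTheory Filter Topology

/-- The second derivative of `F` multiplied by a rescaled cutoff `χ (ε x)`. -/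
theorem deriv_deriv_mul_comp_const_mul {F F' F'' χ : ℝ → ℝ}
    (hF : ∀ x, HasDerivAt F (F' x) x) (hF' : ∀ x, HasDerivAt F' (F'' x) x)
    (hχ : ContDiff ℝ (⊤ : ℕ∞) χ) (ε x : ℝ) :
    deriv (deriv fun y => F y * χ (ε * y)) x =
      F'' x * χ (ε * x) + 2 * ε * F' x * deriv χ (ε * x)
        + ε ^ 2 * F x * deriv (deriv χ) (ε * x) := by
  have hlin (y : ℝ) : HasDerivAt (fun y => ε * y) ε y := by
    simpa using (hasDerivAt_id y).const_mul ε
  have hdχ : ContDiff ℝ (⊤ : ℕ∞) (deriv χ) := (contDiff_infty_iff_deriv.1 hχ).2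
  have h₁ (y : ℝ) : HasDerivAt (fun y => χ (ε * y)) (deriv χ (ε * y) * ε) y :=
    ((hχ.differentiable (by simp)) _).hasDerivAt.comp y (hlin y)
  have h₂ (y : ℝ) : HasDerivAt (fun y => deriv χ (ε * y)) (deriv (deriv χ) (ε * y) * ε) y :=
    ((hdχ.differentiable (by simp)) _).hasDerivAt.comp y (hlin y)
  have hd : (deriv fun y => F y * χ (ε * y)) =
      fun y => F' y * χ (ε * y) + F y * (deriv χ (ε * y) * ε) :=
    funext fun y => ((hF y).mul (h₁ y)).deriv
  rw [hd]
  refine (((hF' x).mul (h₁ x)).add ((hF x).mul ((h₂ x).mul_const ε))).deriv.trans ?_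
  ring

theorem hasDerivAt_sqrt_one_add_sq (x : ℝ) :
    HasDerivAt (fun y : ℝ => √(1 + y ^ 2)) (x / √(1 + x ^ 2)) x := by
  have h : HasDerivAt (fun y : ℝ => 1 + y ^ 2) (2 * x) x := by
    simpa using (hasDerivAt_pow 2 x).const_add 1
  convert h.sqrt (by positivity) using 1
  field_simp

theorem hasDerivAt_div_sqrt_one_add_sq (x : ℝ) :
    HasDerivAt (fun y : ℝ => y / √(1 + y ^ 2)) (1 / √(1 + x ^ 2) ^ 3) x := by
  have hs : 0 < √(1 + x ^ 2) := by positivity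
  have hsq : √(1 + x ^ 2) ^ 2 = 1 + x ^ 2 := Real.sq_sqrt (by positivity)
  refine ((hasDerivAt_id x).div (hasDerivAt_sqrt_one_add_sq x) hs.ne').congr_deriv ?_
  simp only [id]
  field_simp
  linarith

/-- A bounded nonnegative function `a` for which `∫ a f'' dμ` vanishes on all test functions `f`
is zero almost everywhere. -/
theorem ae_eq_zero_of_integral_mul_deriv_deriv_eq_zero {a : ℝ → ℝ} (ha : Measurable a)
    (ha0 : ∀ x, 0 ≤ a x) {M : ℝ} (haM : ∀ x, a x ≤ M)
    (μ : Measure ℝ) [IsFiniteMeasure μ]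
    (hsol : ∀ f : ℝ → ℝ, ContDiff ℝ (⊤ : ℕ∞) f → HasCompactSupport f →
      ∫ x, a x * deriv (deriv f) x ∂μ = 0) :
    a =ᵐ[μ] 0 := by
  obtain ⟨χ, hχ, hχc, hχ0⟩ : ∃ χ : ℝ → ℝ, ContDiff ℝ (⊤ : ℕ∞) χ ∧ HasCompactSupport χ ∧
      χ 0 = 1 := by
    let b : ContDiffBump (0 : ℝ) := ⟨1, 2, one_pos, one_lt_two⟩
    exact ⟨b, b.contDiff, b.hasCompactSupport,
      b.one_of_mem_closedBall (Metric.mem_closedBall_self b.rIn_pos.le)⟩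
  have hχ' : ContDiff ℝ (⊤ : ℕ∞) (deriv χ) := (contDiff_infty_iff_deriv.1 hχ).2
  have hχ'' : ContDiff ℝ (⊤ : ℕ∞) (deriv (deriv χ)) := (contDiff_infty_iff_deriv.1 hχ').2
  obtain ⟨A, hA⟩ := hχc.exists_bound_of_continuous hχ.continuous
  obtain ⟨B, hB⟩ := hχc.deriv.exists_bound_of_continuous hχ'.continuous
  obtain ⟨C, hC⟩ := (hχc.deriv.deriv.mul_left (f := fun y : ℝ => 1 + |y|)
    ).exists_bound_of_continuous ((by fun_prop : Continuous fun y : ℝ => 1 + |y|).mul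
      hχ''.continuous)
  simp only [Pi.mul_apply, Real.norm_eq_abs] at hA hB hC
  let F : ℝ → ℝ := fun x => √(1 + x ^ 2)
  let F' : ℝ → ℝ := fun x => x / √(1 + x ^ 2)
  let F'' : ℝ → ℝ := fun x => 1 / √(1 + x ^ 2) ^ 3
  have hF1 (x : ℝ) : 1 ≤ F x := Real.one_le_sqrt.2 (by nlinarith [sq_nonneg x])
  have hFle (x : ℝ) : F x ≤ 1 + |x| :=
    Real.sqrt_le_iff.2 ⟨by positivity, by nlinarith [abs_nonneg x, sq_abs x]⟩
  have hF'le (x : ℝ) : |F' x| ≤ 1 := by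
    rw [abs_div, abs_of_pos (zero_lt_one.trans_le (hF1 x)),
      div_le_one (zero_lt_one.trans_le (hF1 x))]
    exact Real.abs_le_sqrt (by linarith)
  have hF''pos (x : ℝ) : 0 < F'' x := by positivity
  have hF''le (x : ℝ) : F'' x ≤ 1 :=
    (div_le_one (by positivity)).2 (one_le_pow₀ (hF1 x))
  have hFsmooth : ContDiff ℝ (⊤ : ℕ∞) F :=
    (by fun_prop : ContDiff ℝ (⊤ : ℕ∞) fun x : ℝ => 1 + x ^ 2).sqrt fun x => by positivity
  have hF''meas : Measurable F'' := by fun_prop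
  have hεpos (n : ℕ) : (0 : ℝ) < 1 / ((n : ℝ) + 1) := by positivity
  have hεle (n : ℕ) : 1 / ((n : ℝ) + 1) ≤ 1 :=
    (div_le_one (by positivity)).2 (by linarith [n.cast_nonneg (α := ℝ)])
  let f : ℕ → ℝ → ℝ := fun n x => F x * χ (1 / ((n : ℝ) + 1) * x)
  have hf0 (n : ℕ) : ∫ x, a x * deriv (deriv (f n)) x ∂μ = 0 := by
    refine hsol _ (hFsmooth.mul (hχ.comp (contDiff_const.mul contDiff_id))) ?_
    exact (hχc.comp_homeomorph (Homeomorph.mulLeft₀ _ (hεpos n).ne')).mul_left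
  have hbound (n : ℕ) (x : ℝ) : |deriv (deriv (f n)) x| ≤ A + 2 * B + C := by
    rw [deriv_deriv_mul_comp_const_mul hasDerivAt_sqrt_one_add_sq
      hasDerivAt_div_sqrt_one_add_sq hχ]
    set ε := 1 / ((n : ℝ) + 1)
    have hε := hεpos n
    have hε1 := hεle n
    refine (abs_add_three _ _ _).trans (add_le_add_three ?_ ?_ ?_)
    · rw [abs_mul, abs_of_pos (hF''pos x)]
      exact (mul_le_of_le_one_left (abs_nonneg _) (hF''le x)).trans (hA _)
    · rw [abs_mul, abs_mul, abs_mul, abs_of_pos hε, abs_two]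
      have h : ε * |F' x| ≤ 1 := mul_le_one₀ hε1 (abs_nonneg _) (hF'le x)
      calc 2 * ε * |F' x| * |deriv χ (ε * x)| = 2 * (ε * |F' x| * |deriv χ (ε * x)|) := by ring
        _ ≤ 2 * B := by
          gcongr
          exact (mul_le_of_le_one_left (abs_nonneg _) h).trans (hB _)
    · have h : ε ^ 2 * F x ≤ 1 + |ε * x| := by
        rw [abs_mul, abs_of_pos hε]
        have := mul_le_mul_of_nonneg_left (hFle x) (sq_nonneg ε)
        nlinarith [mul_nonneg (mul_nonneg hε.le (sub_nonneg.2 hε1)) (abs_nonneg x)]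
      refine le_trans ?_ (hC (ε * x))
      have h0 : 0 ≤ ε ^ 2 * F x := mul_nonneg (sq_nonneg _) (zero_le_one.trans (hF1 x))
      rw [abs_mul, abs_mul _ (deriv (deriv χ) (ε * x)), abs_of_nonneg h0,
        abs_of_nonneg (by positivity : 0 ≤ 1 + |ε * x|)]
      exact mul_le_mul_of_nonneg_right h (abs_nonneg _)
  have hlim (x : ℝ) : Tendsto (fun n => deriv (deriv (f n)) x) atTop (𝓝 (F'' x)) := by
    have hcont : Continuous fun ε : ℝ => F'' x * χ (ε * x) + 2 * ε * F' x * deriv χ (ε * x)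
        + ε ^ 2 * F x * deriv (deriv χ) (ε * x) := by
      have := hχ.continuous
      have := hχ'.continuous
      have := hχ''.continuous
      fun_prop
    have h := (hcont.tendsto 0).comp (tendsto_one_div_add_atTop_nhds_zero_nat (𝕜 := ℝ))
    simp only [zero_mul, hχ0, mul_one, mul_zero, add_zero, ne_eq, OfNat.ofNat_ne_zero,
      not_false_eq_true, zero_pow] at h
    refine h.congr fun n => ?_
    exact (deriv_deriv_mul_comp_const_mul hasDerivAt_sqrt_one_add_sq
      hasDerivAt_div_sqrt_one_add_sq hχ _ x).symm
  have hint0 : ∫ x, a x * F'' x ∂μ = 0 := by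
    have h := tendsto_integral_of_dominated_convergence (μ := μ)
      (F := fun n x => a x * deriv (deriv (f n)) x) (f := fun x => a x * F'' x)
      (fun _ => M * (A + 2 * B + C))
      (fun n => (ha.mul (measurable_deriv _)).aestronglyMeasurable) (integrable_const _)
      (fun n => ae_of_all _ fun x => by
        rw [Real.norm_eq_abs, abs_mul, abs_of_nonneg (ha0 x)]
        exact mul_le_mul (haM x) (hbound n x) (abs_nonneg _) ((ha0 x).trans (haM x)))
      (ae_of_all _ fun x => (hlim x).const_mul _)
    simp only [hf0] at h
    exact tendsto_nhds_unique h tendsto_const_nhds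
  have hint : Integrable (fun x => a x * F'' x) μ := by
    refine Integrable.of_bound (ha.mul hF''meas).aestronglyMeasurable M (ae_of_all _ fun x => ?_)
    rw [Real.norm_of_nonneg (mul_nonneg (ha0 x) (hF''pos x).le)]
    exact (mul_le_of_le_one_right (ha0 x) (hF''le x)).trans (haM x)
  filter_upwards [(integral_eq_zero_iff_of_nonneg
    (fun x => mul_nonneg (ha0 x) (hF''pos x).le) hint).1 hint0] with x hx
  exact (mul_eq_zero.1 hx).resolve_right (hF''pos x).ne'

/-- in dimension one, for `a = σ²` with `σ` bounded Borel and injective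
(`σ(x) ≠ σ(y)` for `x ≠ y`) and zero drift, any probability measure `μ` with
`∫ a f'' dμ = 0` for all `f ∈ C_c^∞(ℝ)` is a Dirac measure at a zero of `a`. -/
theorem one_dimensional_prob_solution_is_dirac
    (σ : ℝ → ℝ) (hσmeas : Measurable σ)
    (hσbd : ∃ M : ℝ, ∀ x, |σ x| ≤ M)
    (hσinj : ∀ x y : ℝ, x ≠ y → σ x ≠ σ y)
    (μ : Measure ℝ) (hμ : IsProbabilityMeasure μ)
    (hsol : ∀ f : ℝ → ℝ, ContDiff ℝ (⊤ : ℕ∞) f → HasCompactSupport f →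
      ∫ x, σ x ^ 2 * deriv (deriv f) x ∂μ = 0) :
    ∃ x₀ : ℝ, σ x₀ ^ 2 = 0 ∧ μ = Measure.dirac x₀ := by
  obtain ⟨M, hM⟩ := hσbd
  have hae : ∀ᵐ x ∂μ, σ x ^ 2 = 0 :=
    ae_eq_zero_of_integral_mul_deriv_deriv_eq_zero (hσmeas.pow_const 2) (fun x => sq_nonneg _)
      (fun x => sq_le_sq' (abs_le.1 (hM x)).1 (abs_le.1 (hM x)).2) μ hsol
  obtain ⟨x₀, hx₀⟩ := hae.exists
  refine ⟨x₀, hx₀, ?_⟩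
  have hconst : ∀ᵐ x ∂μ, x = x₀ := by
    filter_upwards [hae] with x hx
    by_contra hne
    exact hσinj x x₀ hne ((pow_eq_zero_iff two_ne_zero).1 hx |>.trans
      ((pow_eq_zero_iff two_ne_zero).1 hx₀).symm)
  calc μ = μ.map id := Measure.map_id.symm
    _ = μ.map fun _ => x₀ := Measure.map_congr hconst
    _ = Measure.dirac x₀ := by rw [Measure.map_const, measure_univ, one_smul]
end

section
/- Let γ be the centered Gaussian probability measure on ℝ that is the stationary distribution of the Ornstein–Uhlenbeck process dX_t = dW_t − X_t dt (i.e., γ has mean 0 and variance 1/2), and on ℝ² = ℝ × ℝ define the doubled Ornstein–Uhlenbeck operator 𝕃ψ(x,y) = (1/2)∂²_{xx}ψ(x,y) + ∂²_{xy}ψ(x,y) + (1/2)∂²_{yy}ψ(x,y) − x ∂_x ψ(x,y) − y ∂_y ψ(x,y). Then the product measure γ ⊗ γ is not a solution of 𝕃*(γ⊗γ) = 0: there exists ψ ∈ C_c^∞(ℝ²) with ∫_{ℝ²} 𝕃ψ d(γ⊗γ) ≠ 0. -/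
open MeasureTheory

noncomputable section

/-- The doubled Ornstein–Uhlenbeck operator on `ℝ × ℝ`:
`𝕃ψ(x,y) = (1/2)∂²ₓₓψ + ∂²ₓᵧψ + (1/2)∂²ᵧᵧψ − x ∂ₓψ − y ∂ᵧψ`. -/
def ouDblOp (ψ : ℝ × ℝ → ℝ) (p : ℝ × ℝ) : ℝ :=
  (1 / 2) * iteratedFDeriv ℝ 2 ψ p ![((1 : ℝ), (0 : ℝ)), ((1 : ℝ), (0 : ℝ))]
    + iteratedFDeriv ℝ 2 ψ p ![((1 : ℝ), (0 : ℝ)), ((0 : ℝ), (1 : ℝ))]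
    + (1 / 2) * iteratedFDeriv ℝ 2 ψ p ![((0 : ℝ), (1 : ℝ)), ((0 : ℝ), (1 : ℝ))]
    - p.1 * fderiv ℝ ψ p ((1 : ℝ), (0 : ℝ))
    - p.2 * fderiv ℝ ψ p ((0 : ℝ), (1 : ℝ))

open ProbabilityTheory

/-- **Stein's identity** for the centered Gaussian of variance `1 / 2`. -/
theorem integral_deriv_gaussianReal_half {h : ℝ → ℝ} (hh : ContDiff ℝ 1 h)
    (hc : HasCompactSupport h) :
    ∫ x, deriv h x ∂(gaussianReal 0 (1 / 2)) = ∫ x, 2 * x * h x ∂(gaussianReal 0 (1 / 2)) := by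
  have hv : (1 / 2 : NNReal) ≠ 0 := by norm_num
  have hg : ∀ x, HasDerivAt (gaussianPDFReal 0 (1 / 2))
      (-(2 * x) * gaussianPDFReal 0 (1 / 2) x) x := fun x ↦ by
    have hexp : HasDerivAt
        (fun y : ℝ ↦ -(y - 0) ^ 2 / (2 * ((1 / 2 : NNReal) : ℝ))) (-(2 * x)) x := by
      have := (((hasDerivAt_id x).sub_const 0).fun_pow 2).fun_neg.div_const
        (2 * ((1 / 2 : NNReal) : ℝ))
      refine this.congr_deriv ?_
      simp
    unfold gaussianPDFReal
    exact (hexp.exp.const_mul _).congr_deriv (by ring)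
  have hgc : Continuous (gaussianPDFReal 0 (1 / 2)) :=
    continuous_iff_continuousAt.2 fun x ↦ (hg x).continuousAt
  have hdc : Continuous (deriv h) := hh.continuous_deriv le_rfl
  have key := integral_mul_deriv_eq_deriv_mul_of_integrable (u := h)
    (v := gaussianPDFReal 0 (1 / 2)) (u' := deriv h)
    (v' := fun x ↦ -(2 * x) * gaussianPDFReal 0 (1 / 2) x)
    (fun x _ ↦ (hh.differentiable one_ne_zero x).hasDerivAt) (fun x _ ↦ hg x)
    ((hh.continuous.mul (by fun_prop)).integrable_of_hasCompactSupport hc.mul_right)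
    ((hdc.mul hgc).integrable_of_hasCompactSupport hc.deriv.mul_right)
    ((hh.continuous.mul hgc).integrable_of_hasCompactSupport hc.mul_right)
  rw [integral_gaussianReal_eq_integral_smul hv, integral_gaussianReal_eq_integral_smul hv]
  simp only [smul_eq_mul]
  rw [← neg_inj, ← integral_neg]
  calc _ = -∫ x, deriv h x * gaussianPDFReal 0 (1 / 2) x := by
        rw [← integral_neg]; congr 1; ext x; ring
    _ = _ := by rw [← key, ← integral_neg]; congr 1; ext x; ring

/-- Action of `ouDblOp` on a tensor square `f ⊗ f`. -/
theorem ouDblOp_tensor_self {f : ℝ → ℝ} (hf : ContDiff ℝ 2 f) (p : ℝ × ℝ) :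
    ouDblOp (fun q ↦ f q.1 * f q.2) p =
      (1 / 2 * deriv (deriv f) p.1 - p.1 * deriv f p.1) * f p.2
        + f p.1 * (1 / 2 * deriv (deriv f) p.2 - p.2 * deriv f p.2)
        + deriv f p.1 * deriv f p.2 := by
  have hf1 : ContDiff ℝ 1 (deriv f) := ContDiff.deriv' (n := 1)
    (by simpa [one_add_one_eq_two] using hf)
  have d0 : ∀ x, HasDerivAt f (deriv f x) x := fun x ↦
    (hf.differentiable two_ne_zero x).hasDerivAt
  have d1 : ∀ x, HasDerivAt (deriv f) (deriv (deriv f) x) x := fun x ↦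
    (hf1.differentiable one_ne_zero x).hasDerivAt
  have c1 : ∀ {g g' : ℝ → ℝ}, (∀ x, HasDerivAt g (g' x) x) → ∀ q : ℝ × ℝ,
      HasFDerivAt (fun q : ℝ × ℝ ↦ g q.1) (g' q.1 • ContinuousLinearMap.fst ℝ ℝ ℝ) q :=
    fun hg q ↦ (hg q.1).comp_hasFDerivAt q hasFDerivAt_fst
  have c2 : ∀ {g g' : ℝ → ℝ}, (∀ x, HasDerivAt g (g' x) x) → ∀ q : ℝ × ℝ,
      HasFDerivAt (fun q : ℝ × ℝ ↦ g q.2) (g' q.2 • ContinuousLinearMap.snd ℝ ℝ ℝ) q :=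
    fun hg q ↦ (hg q.2).comp_hasFDerivAt q hasFDerivAt_snd
  have e1 : fderiv ℝ (fun q : ℝ × ℝ ↦ f q.1 * f q.2) = fun q ↦
      (f q.1 * deriv f q.2) • ContinuousLinearMap.snd ℝ ℝ ℝ
        + (f q.2 * deriv f q.1) • ContinuousLinearMap.fst ℝ ℝ ℝ := by
    funext q
    rw [((c1 d0 q).fun_mul (c2 d0 q)).fderiv]
    simp only [smul_smul]
  have e2 := ((((c1 d0 p).fun_mul (c2 d1 p)).smul_const (ContinuousLinearMap.snd ℝ ℝ ℝ)).fun_add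
    (((c2 d0 p).fun_mul (c1 d1 p)).smul_const (ContinuousLinearMap.fst ℝ ℝ ℝ))).fderiv
  simp only [ouDblOp, iteratedFDeriv_two_apply, e1, e2]
  simp
  ring

theorem integral_ouDblOp_tensor_self {f : ℝ → ℝ} (hf : ContDiff ℝ 2 f)
    (hc : HasCompactSupport f) :
    ∫ p, ouDblOp (fun q ↦ f q.1 * f q.2) p
        ∂((gaussianReal 0 (1 / 2)).prod (gaussianReal 0 (1 / 2))) =
      (∫ x, deriv f x ∂(gaussianReal 0 (1 / 2))) ^ 2 := by
  set γ := gaussianReal 0 (1 / 2)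
  have hf1 : ContDiff ℝ 1 (deriv f) := ContDiff.deriv' (n := 1)
    (by simpa [one_add_one_eq_two] using hf)
  have i0 : Integrable f γ := hf.continuous.integrable_of_hasCompactSupport hc
  have i1 : Integrable (deriv f) γ := hf1.continuous.integrable_of_hasCompactSupport hc.deriv
  have i2 : Integrable (deriv (deriv f)) γ :=
    (hf1.continuous_deriv le_rfl).integrable_of_hasCompactSupport hc.deriv.deriv
  have ix : Integrable (fun x ↦ x * deriv f x) γ :=
    (continuous_id.mul hf1.continuous).integrable_of_hasCompactSupport hc.deriv.mul_left
  have iL : Integrable (fun x ↦ 1 / 2 * deriv (deriv f) x - x * deriv f x) γ :=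
    (i2.const_mul _).sub ix
  have hL : ∫ x, (1 / 2 * deriv (deriv f) x - x * deriv f x) ∂γ = 0 := by
    rw [integral_sub (i2.const_mul _) ix, integral_const_mul,
      integral_deriv_gaussianReal_half hf1 hc.deriv, ← integral_const_mul, sub_eq_zero]
    congr 1; ext x; ring
  simp only [ouDblOp_tensor_self hf]
  have iLL : Integrable (fun p : ℝ × ℝ ↦
      (1 / 2 * deriv (deriv f) p.1 - p.1 * deriv f p.1) * f p.2
        + f p.1 * (1 / 2 * deriv (deriv f) p.2 - p.2 * deriv f p.2)) (γ.prod γ) :=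
    (iL.mul_prod i0).add (i0.mul_prod iL)
  rw [integral_add iLL (i1.mul_prod i1), integral_add (iL.mul_prod i0) (i0.mul_prod iL),
    integral_prod_mul (fun x ↦ 1 / 2 * deriv (deriv f) x - x * deriv f x) f,
    integral_prod_mul f (fun x ↦ 1 / 2 * deriv (deriv f) x - x * deriv f x),
    integral_prod_mul, hL]
  ring

/-- for the centered Gaussian measure `γ` with mean `0` and variance `1/2`
(the stationary distribution of `dX_t = dW_t − X_t dt`), the product `γ ⊗ γ` does not
solve the doubled Ornstein–Uhlenbeck equation `𝕃*(γ⊗γ) = 0`. -/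
theorem product_gaussian_not_doubled_solution :
    ∃ ψ : ℝ × ℝ → ℝ, ContDiff ℝ (⊤ : ℕ∞) ψ ∧ HasCompactSupport ψ ∧
      ∫ p, ouDblOp ψ p
        ∂((ProbabilityTheory.gaussianReal 0 (1 / 2)).prod
            (ProbabilityTheory.gaussianReal 0 (1 / 2))) ≠ 0 := by
  let f : ContDiffBump (2 : ℝ) := ⟨1 / 2, 1, by norm_num, by norm_num⟩
  have hf : ContDiff ℝ (⊤ : ℕ∞) f := f.contDiff
  refine ⟨fun q ↦ f q.1 * f q.2, (hf.comp contDiff_fst).mul (hf.comp contDiff_snd), ?_, ?_⟩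
  · refine HasCompactSupport.intro (f.hasCompactSupport.isCompact.prod
      f.hasCompactSupport.isCompact) fun q hq ↦ ?_
    by_contra h
    exact hq ⟨subset_tsupport _ (left_ne_zero_of_mul h), subset_tsupport _ (right_ne_zero_of_mul h)⟩
  · rw [integral_ouDblOp_tensor_self f.contDiff f.hasCompactSupport,
      integral_deriv_gaussianReal_half f.contDiff f.hasCompactSupport]
    have hsupp : Function.support (fun x ↦ 2 * x * f x) = Metric.ball 2 1 := by
      ext x
      have hx : f x ≠ 0 ↔ x ∈ Metric.ball (2 : ℝ) 1 := by
        rw [← Function.mem_support, f.support_eq]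
      simp only [Function.mem_support, mul_ne_zero_iff, hx]
      refine ⟨fun h ↦ h.2, fun h ↦ ⟨⟨two_ne_zero, ?_⟩, h⟩⟩
      rintro rfl
      norm_num [Real.dist_eq] at h
    refine pow_ne_zero 2 (ne_of_gt ?_)
    rw [integral_pos_iff_support_of_nonneg, hsupp]
    · refine pos_iff_ne_zero.2 fun h ↦ ?_
      have hac := gaussianReal_absolutelyContinuous' 0 (v := 1 / 2) (by norm_num) h
      exact (Metric.measure_ball_pos volume (2 : ℝ) one_pos).ne' hac
    · intro x
      by_cases h : x ∈ Metric.ball (2 : ℝ) 1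
      · rw [Real.ball_eq_Ioo] at h
        have : 0 ≤ x := by linarith [h.1]
        exact mul_nonneg (by positivity) f.nonneg
      · rw [← hsupp, Function.notMem_support] at h
        exact h.ge
    · exact ((continuous_const.mul continuous_id).mul
        f.continuous).integrable_of_hasCompactSupport f.hasCompactSupport.mul_left
end
end
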